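/- Let X, Y, Z, W be four points in H³ such that the segments XY, ZW have length at least D > 3, the segment YZ has length at least 2D, and the angles ∠XYZ and ∠YZW are both at least δ for some δ > π/4. Then the angle at X between the segments XY and XW is at most 40·e^{-D}. -/

import Mathlib

/-- Inverse hyperbolic cosine. -/
noncomputable def arcosh (x : ℝ) : ℝ := Real.log (x + Real.sqrt (x ^ 2 - 1))

/-- Hyperbolic distance between two points of the upper half-space model of `H³`
(points of `ℝ × ℝ × ℝ` with positive third coordinate), given by the standard formula
`cosh d = 1 + ‖p - q‖² / (2 zₚ z_q)`. -/
noncomputable def hDist (p q : ℝ × ℝ × ℝ) : ℝ :=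
  arcosh (1 + ((p.1 - q.1) ^ 2 + (p.2.1 - q.2.1) ^ 2 + (p.2.2 - q.2.2) ^ 2) /
    (2 * p.2.2 * q.2.2))

/-- The hyperbolic angle `∠XYZ` at the vertex `Y`, recovered from the side lengths of the
triangle `XYZ` via the hyperbolic law of cosines. -/
noncomputable def hAngle (X Y Z : ℝ × ℝ × ℝ) : ℝ :=
  Real.arccos ((Real.cosh (hDist Y X) * Real.cosh (hDist Y Z) - Real.cosh (hDist X Z)) /
    (Real.sinh (hDist Y X) * Real.sinh (hDist Y Z)))

/-- The hyperbolic cosine of the distance between two points of the upper half-space. -/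
noncomputable def coshDist (p q : ℝ × ℝ × ℝ) : ℝ :=
  1 + ((p.1 - q.1) ^ 2 + (p.2.1 - q.2.1) ^ 2 + (p.2.2 - q.2.2) ^ 2) / (2 * p.2.2 * q.2.2)

theorem one_le_coshDist {p q : ℝ × ℝ × ℝ} (hp : 0 < p.2.2) (hq : 0 < q.2.2) :
    1 ≤ coshDist p q := by
  unfold coshDist
  have : 0 ≤ ((p.1 - q.1) ^ 2 + (p.2.1 - q.2.1) ^ 2 + (p.2.2 - q.2.2) ^ 2) /
    (2 * p.2.2 * q.2.2) := by positivity
  linarith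

theorem arcosh_nonneg {x : ℝ} (hx : 1 ≤ x) : 0 ≤ arcosh x :=
  Real.log_nonneg (by linarith [Real.sqrt_nonneg (x ^ 2 - 1)])

theorem cosh_arcosh {x : ℝ} (hx : 1 ≤ x) : Real.cosh (arcosh x) = x := by
  have hs := Real.sq_sqrt (show 0 ≤ x ^ 2 - 1 by nlinarith)
  have hpos : 0 < x + Real.sqrt (x ^ 2 - 1) := by linarith [Real.sqrt_nonneg (x ^ 2 - 1)]
  rw [arcosh, Real.cosh_log hpos]
  field_simp
  nlinarith

theorem hDist_nonneg {p q : ℝ × ℝ × ℝ} (hp : 0 < p.2.2) (hq : 0 < q.2.2) : 0 ≤ hDist p q :=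
  arcosh_nonneg (one_le_coshDist hp hq)

theorem cosh_hDist {p q : ℝ × ℝ × ℝ} (hp : 0 < p.2.2) (hq : 0 < q.2.2) :
    Real.cosh (hDist p q) = coshDist p q :=
  cosh_arcosh (one_le_coshDist hp hq)

theorem hDist_comm (p q : ℝ × ℝ × ℝ) : hDist p q = hDist q p := by
  unfold hDist
  congr 2
  congr 1 <;> ring

/-- The initial velocity at `Y` of the geodesic from `Y` to `P`, scaled to have length
`sinh d(Y, P)` and written in an orthonormal frame at `Y`. -/
noncomputable def initialVelocity (Y P : ℝ × ℝ × ℝ) : ℝ × ℝ × ℝ :=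
  ((P.1 - Y.1) / P.2.2, (P.2.1 - Y.2.1) / P.2.2,
    (((P.1 - Y.1) ^ 2 + (P.2.1 - Y.2.1) ^ 2 + P.2.2 ^ 2) / (Y.2.2 * P.2.2) - Y.2.2 / P.2.2) / 2)

theorem coshDist_eq {Y P Q : ℝ × ℝ × ℝ} (hY : 0 < Y.2.2) (hP : 0 < P.2.2) (hQ : 0 < Q.2.2) :
    coshDist P Q = coshDist Y P * coshDist Y Q -
      ((initialVelocity Y P).1 * (initialVelocity Y Q).1 +
        (initialVelocity Y P).2.1 * (initialVelocity Y Q).2.1 +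
        (initialVelocity Y P).2.2 * (initialVelocity Y Q).2.2) := by
  simp only [coshDist, initialVelocity]
  field_simp
  ring

theorem sinh_hDist_sq {Y P : ℝ × ℝ × ℝ} (hY : 0 < Y.2.2) (hP : 0 < P.2.2) :
    Real.sinh (hDist Y P) ^ 2 = (initialVelocity Y P).1 ^ 2 +
      (initialVelocity Y P).2.1 ^ 2 + (initialVelocity Y P).2.2 ^ 2 := by
  have h := coshDist_eq hY hP hP
  have h1 : coshDist P P = 1 := by simp [coshDist]
  rw [Real.sinh_sq, cosh_hDist hY hP]
  linarith

/-- The cosine of the angle `∠XYZ` as given by the hyperbolic law of cosines. -/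
noncomputable def cosAngle (X Y Z : ℝ × ℝ × ℝ) : ℝ :=
  (Real.cosh (hDist Y X) * Real.cosh (hDist Y Z) - Real.cosh (hDist X Z)) /
    (Real.sinh (hDist Y X) * Real.sinh (hDist Y Z))

theorem cosAngle_le_of_le_hAngle {X Y Z : ℝ × ℝ × ℝ} {δ : ℝ} (hδ : Real.pi / 4 < δ)
    (h : δ ≤ hAngle X Y Z) : cosAngle X Y Z ≤ 0.7072 := by
  by_contra! hc
  have h2 : Real.sqrt 2 / 2 ≤ 0.7072 := by
    have : Real.sqrt 2 ≤ 1.4144 := Real.sqrt_le_iff.2 (by norm_num)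
    linarith
  have h3 : hAngle X Y Z ≤ Real.arccos (Real.cos (Real.pi / 4)) := by
    refine Real.arccos_le_arccos ?_
    rw [Real.cos_pi_div_four]
    exact (h2.trans_lt hc).le
  rw [Real.arccos_cos (by positivity) (by linarith [Real.pi_pos])] at h3
  linarith

theorem one_sub_cosAngle_le_add {Y P Q R : ℝ × ℝ × ℝ} (hY : 0 < Y.2.2) (hP : 0 < P.2.2)
    (hQ : 0 < Q.2.2) (hR : 0 < R.2.2) (hYP : 0 < hDist Y P) (hYQ : 0 < hDist Y Q)
    (hYR : 0 < hDist Y R) :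
    1 - cosAngle P Y Q ≤ 2 * (1 - cosAngle P Y R) + 2 * (1 - cosAngle Q Y R) := by
  have sP := Real.sinh_pos_iff.2 hYP
  have sQ := Real.sinh_pos_iff.2 hYQ
  have sR := Real.sinh_pos_iff.2 hYR
  have nP := sinh_hDist_sq hY hP
  have nQ := sinh_hDist_sq hY hQ
  have nR := sinh_hDist_sq hY hR
  simp only [cosAngle, cosh_hDist, hY, hP, hQ, hR]
  rw [coshDist_eq hY hP hQ, coshDist_eq hY hP hR, coshDist_eq hY hQ hR]
  generalize Real.sinh (hDist Y P) = p at *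
  generalize Real.sinh (hDist Y Q) = q at *
  generalize Real.sinh (hDist Y R) = r at *
  generalize initialVelocity Y P = vP at *
  obtain ⟨p1, p2, p3⟩ := vP
  generalize initialVelocity Y Q = vQ at *
  obtain ⟨q1, q2, q3⟩ := vQ
  generalize initialVelocity Y R = vR at *
  obtain ⟨r1, r2, r3⟩ := vR
  simp only [sub_sub_cancel] at *
  have uP : (p1 / p) ^ 2 + (p2 / p) ^ 2 + (p3 / p) ^ 2 = 1 := by field_simp; linarith
  have uQ : (q1 / q) ^ 2 + (q2 / q) ^ 2 + (q3 / q) ^ 2 = 1 := by field_simp; linarith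
  have uR : (r1 / r) ^ 2 + (r2 / r) ^ 2 + (r3 / r) ^ 2 = 1 := by field_simp; linarith
  simp only [add_div, mul_div_mul_comm]
  nlinarith [sq_nonneg (p1 / p + q1 / q - 2 * (r1 / r)),
    sq_nonneg (p2 / p + q2 / q - 2 * (r2 / r)), sq_nonneg (p3 / p + q3 / q - 2 * (r3 / r))]

/-- If the cosine of the angle at `Y` is at most `k`, the opposite side is long. -/
theorem mul_cosh_mul_cosh_le {X Y Z : ℝ × ℝ × ℝ} {k : ℝ} (hk : 0 ≤ k)
    (hYX : 0 < hDist Y X) (hYZ : 0 < hDist Y Z) (h : cosAngle X Y Z ≤ k) :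
    (1 - k) * (Real.cosh (hDist Y X) * Real.cosh (hDist Y Z)) ≤ Real.cosh (hDist X Z) := by
  have s1 := Real.sinh_pos_iff.2 hYX
  have s2 := Real.sinh_pos_iff.2 hYZ
  rw [cosAngle, div_le_iff₀ (mul_pos s1 s2)] at h
  have h1 := mul_le_mul (Real.sinh_lt_cosh (hDist Y X)).le (Real.sinh_lt_cosh (hDist Y Z)).le
    s2.le (Real.cosh_pos _).le
  nlinarith [mul_le_mul_of_nonneg_left h1 hk]

theorem one_sub_cosAngle_le {X Y Z : ℝ × ℝ × ℝ} (hYX : 0 < hDist Y X) (hYZ : 0 < hDist Y Z) :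
    1 - cosAngle X Y Z ≤
      Real.cosh (hDist X Z) / (Real.sinh (hDist Y X) * Real.sinh (hDist Y Z)) := by
  have s1 := Real.sinh_pos_iff.2 hYX
  have s2 := Real.sinh_pos_iff.2 hYZ
  have h1 := mul_le_mul (Real.sinh_lt_cosh (hDist Y X)).le (Real.sinh_lt_cosh (hDist Y Z)).le
    s2.le (Real.cosh_pos _).le
  rw [cosAngle, one_sub_div (mul_pos s1 s2).ne']
  gcongr
  linarith

theorem mul_cosh_le_sinh {x : ℝ} (hx : 0 ≤ x) (h : 10 ≤ Real.cosh x) :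
    0.9 * Real.cosh x ≤ Real.sinh x := by
  refine (pow_le_pow_iff_left₀ (by positivity) (Real.sinh_nonneg_iff.2 hx) two_ne_zero).1 ?_
  rw [Real.sinh_sq]
  nlinarith

theorem pos_of_one_lt_cosh {x : ℝ} (hx : 0 ≤ x) (h : 1 < Real.cosh x) : 0 < x := by
  rcases hx.eq_or_lt with rfl | hx
  · simp at h
  · exact hx

theorem exp_div_two_le_cosh (x : ℝ) : Real.exp x / 2 ≤ Real.cosh x := by
  rw [Real.cosh_eq]
  linarith [Real.exp_pos (-x)]

theorem twenty_lt_exp_three : 20 < Real.exp 3 := by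
  have h : Real.exp 3 = Real.exp 1 ^ 3 := by rw [← Real.exp_nat_mul]; norm_num
  rw [h]
  calc (20 : ℝ) < 2.718 ^ 3 := by norm_num
    _ ≤ Real.exp 1 ^ 3 := by gcongr; linarith [Real.exp_one_gt_d9]

theorem arccos_le_of_one_sub_le {x η : ℝ} (h0 : 0 ≤ η) (hη : η ≤ 2)
    (h : 1 - x ≤ η ^ 2 / 10) : Real.arccos x ≤ η := by
  have hpi := Real.pi_gt_three
  have hpi' : Real.pi ^ 2 ≤ 20 := by nlinarith [Real.pi_le_four, Real.pi_lt_d2]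
  have hc := Real.cos_le_one_sub_mul_cos_sq (x := η) (by rw [abs_of_nonneg h0]; linarith)
  calc Real.arccos x ≤ Real.arccos (Real.cos η) := by
        refine Real.arccos_le_arccos ?_
        have h3 : (1 : ℝ) / 10 ≤ 2 / Real.pi ^ 2 := by
          rw [div_le_div_iff₀ (by norm_num) (by positivity)]
          linarith
        nlinarith [mul_le_mul_of_nonneg_right h3 (sq_nonneg η)]
    _ = η := Real.arccos_cos h0 (by linarith)

/-- Let `X, Y, Z, W ∈ H³` with `|XY|, |ZW| ≥ D`, `|YZ| ≥ 2D`, `D > 3`, and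
with the angles `∠XYZ` and `∠YZW` both at least `δ` for some `δ > π/4`.  Then the angle at
`X` between the segments `XY` and `XW` is at most `40 e^{-D}`. -/
theorem angle_estimate_two_bends
    (D δ : ℝ) (hD : 3 < D) (hδ : Real.pi / 4 < δ)
    (X Y Z W : ℝ × ℝ × ℝ) (hX : 0 < X.2.2) (hY : 0 < Y.2.2) (hZ : 0 < Z.2.2)
    (hW : 0 < W.2.2)
    (hXY : D ≤ hDist X Y) (hZW : D ≤ hDist Z W) (hYZ : 2 * D ≤ hDist Y Z)
    (hangle1 : δ ≤ hAngle X Y Z) (hangle2 : δ ≤ hAngle Y Z W) :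
    hAngle Y X W ≤ 40 * Real.exp (-D) := by
  have hXY0 : 0 < hDist X Y := by linarith
  have hYX0 : 0 < hDist Y X := by rwa [hDist_comm]
  have hYZ0 : 0 < hDist Y Z := by linarith
  have hZY0 : 0 < hDist Z Y := by rwa [hDist_comm]
  have hZW0 : 0 < hDist Z W := by linarith
  have hE : 20 < Real.exp D := twenty_lt_exp_three.trans (Real.exp_lt_exp.2 hD)
  have hcosh {x : ℝ} (hx : D ≤ x) : Real.exp D / 2 ≤ Real.cosh x :=
    (exp_div_two_le_cosh D).trans (Real.cosh_le_cosh.2 (by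
      rw [abs_of_pos (by linarith), abs_of_pos (by linarith)]; exact hx))
  have ca := hcosh hXY
  have cb := hcosh (show D ≤ hDist Y Z by linarith)
  have cc := hcosh hZW
  have sa := mul_cosh_le_sinh hXY0.le (by linarith)
  have sb := mul_cosh_le_sinh hYZ0.le (by linarith)
  have k1 := cosAngle_le_of_le_hAngle hδ hangle1
  have cf := mul_cosh_mul_cosh_le (by norm_num) hZY0 hZW0
    (cosAngle_le_of_le_hAngle hδ hangle2)
  rw [hDist_comm Z Y] at cf
  have cbc : 100 ≤ Real.cosh (hDist Y Z) * Real.cosh (hDist Z W) := by nlinarith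
  have cf20 : 20 ≤ Real.cosh (hDist Y W) := by linarith
  have hYW0 := pos_of_one_lt_cosh (hDist_nonneg hY hW) (by linarith)
  have sf := mul_cosh_le_sinh hYW0.le (by linarith)
  have k2 : 1 - cosAngle Z Y W ≤ 0.05 := by
    refine (one_sub_cosAngle_le hYZ0 hYW0).trans ?_
    have h1 : 0.9 * 10 * (0.9 * (0.29 * (10 * Real.cosh (hDist Z W)))) ≤
        Real.sinh (hDist Y Z) * Real.sinh (hDist Y W) := by
      refine mul_le_mul (by linarith) ?_ (by positivity) (by linarith)
      nlinarith
    rw [div_le_iff₀ (by nlinarith)]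
    linarith
  have k3 : cosAngle X Y W ≤ 0.91 := by
    linarith [one_sub_cosAngle_le_add hY hX hZ hW hYX0 hYZ0 hYW0]
  have ce := mul_cosh_mul_cosh_le (by norm_num) hYX0 hYW0 k3
  rw [hDist_comm Y X] at ce
  have caf : 200 ≤ Real.cosh (hDist X Y) * Real.cosh (hDist Y W) := by nlinarith
  have hXW0 := pos_of_one_lt_cosh (hDist_nonneg hX hW) (by linarith)
  have se := mul_cosh_le_sinh hXW0.le (by linarith)
  refine arccos_le_of_one_sub_le (by positivity) ?_
    ((one_sub_cosAngle_le hXY0 hXW0).trans ?_)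
  · rw [Real.exp_neg, ← div_eq_mul_inv, div_le_iff₀ (by linarith)]
    linarith
  · have h1 : 0.9 * (Real.exp D / 2) *
        (0.9 * (0.09 * (Real.exp D / 2 * Real.cosh (hDist Y W)))) ≤
        Real.sinh (hDist X Y) * Real.sinh (hDist X W) := by
      refine mul_le_mul (by linarith) ?_ (by positivity) (by linarith)
      nlinarith
    have hf := Real.cosh_pos (hDist Y W)
    calc Real.cosh (hDist Y W) / (Real.sinh (hDist X Y) * Real.sinh (hDist X W))
        ≤ Real.cosh (hDist Y W) / (0.9 * (Real.exp D / 2) *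
          (0.9 * (0.09 * (Real.exp D / 2 * Real.cosh (hDist Y W))))) := by gcongr
      _ ≤ (40 * Real.exp (-D)) ^ 2 / 10 := by
        rw [Real.exp_neg]
        field_simp
        norm_num
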